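/- Let s, t be real numbers with s, t > 1/2, p := (s+1)/(s+t+2), p̄ := (t+1)/(s+t+2). Let G = (V, E) be a finite simple graph on n vertices, let T := ‖V‖ − (s + t + 1)·n, and suppose T ≥ 0, the minimum degree of G satisfies δ(G) > s + t + 1 + T, and G contains no clique of size at least 2s + 2t + 3. Then there exists y ∈ [0,1]^V such that: (1) f₁(y) ≥ p²·T, g₁(y) ≥ p̄²·T, and y ∉ {0⃗, 1⃗}; (2) C := fr(y) is a clique in G; (3) Σ_{v ∈ C} (y_v − y_v²) < (2s + 2t + 3)·p·(1 − p) + (T/(s + t + 2))·p·(1 − p); (4) Σ_{v ∈ V} y_v ≥ 2(s + t + 1)·p and Σ_{v ∈ V} (1 − y_v) ≥ 2(s + t + 1)·p̄. -/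

import Mathlib

open Finset

/-- `G.edgesIn X` is the number of edges of the induced subgraph `G[X]`. -/
noncomputable def SimpleGraph.edgesIn {V : Type*} (G : SimpleGraph V) (X : Finset V) : ℕ :=
  {e ∈ G.edgeSet | ∀ v ∈ e, v ∈ X}.ncard

/-- `f₁(x) = Σ_{uv ∈ E} x_u x_v - (s+t+1) p Σ_{v ∈ V} x_v` where `p = (s+1)/(s+t+2)`,
each edge counted once. -/
noncomputable def SimpleGraph.f1 {V : Type*} [Fintype V] (G : SimpleGraph V)
    (s t : ℝ) (x : V → ℝ) : ℝ :=
  letI := Classical.decEq V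
  letI : DecidableRel G.Adj := Classical.decRel _
  (∑ e ∈ G.edgeFinset, Sym2.lift ⟨fun u v => x u * x v, fun _ _ => mul_comm _ _⟩ e)
    - (s + t + 1) * ((s + 1) / (s + t + 2)) * ∑ v, x v

/-- `g₁(x) = Σ_{uv ∈ E} (1-x_u)(1-x_v) - (s+t+1) p̄ Σ_{v ∈ V} (1-x_v)` where
`p̄ = (t+1)/(s+t+2)`, each edge counted once. -/
noncomputable def SimpleGraph.g1 {V : Type*} [Fintype V] (G : SimpleGraph V)
    (s t : ℝ) (x : V → ℝ) : ℝ :=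
  letI := Classical.decEq V
  letI : DecidableRel G.Adj := Classical.decRel _
  (∑ e ∈ G.edgeFinset,
      Sym2.lift ⟨fun u v => (1 - x u) * (1 - x v), fun _ _ => mul_comm _ _⟩ e)
    - (s + t + 1) * ((t + 1) / (s + t + 2)) * ∑ v, (1 - x v)

theorem fractional_sum_lt {K p T σ h k : ℝ} (hK : 0 < K) (hp0 : 0 < p) (hp : p ≤ 1 / 2)
    (hpK : 1 ≤ p * (K + 1)) (hT : 0 ≤ T) (hσ : 0 ≤ σ) (hhσ : h ≤ σ) (hk : k < 2 * K + 1)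
    (hcs : σ ^ 2 ≤ k * (σ - h)) (hh : h ≤ σ * (1 + 2 * K * p - σ) + 2 * p ^ 2 * T) :
    h < (2 * K + 1) * p * (1 - p) + T / (K + 1) * p * (1 - p) := by
  have hp1 : 0 < 1 - p := by linarith
  rcases hσ.eq_or_lt with rfl | hσ
  · have h1 : 0 < (2 * K + 1) * p * (1 - p) := by positivity
    have h2 : 0 ≤ T / (K + 1) * p * (1 - p) := by positivity
    linarith
  have hpos : 0 < σ - h := by
    refine lt_of_le_of_ne (by linarith) fun h0 => ?_
    rw [← h0] at hcs
    nlinarith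
  have h1 : σ ^ 2 / (2 * K + 1) < σ - h := by
    rw [div_lt_iff₀ (by linarith)]
    nlinarith
  set D := 2 * K + 1 with hD
  have hD0 : 0 < D := by linarith
  set x := σ - D * p with hx
  have hsq : σ ^ 2 / D = D * p ^ 2 + 2 * p * x + x ^ 2 / D := by
    have : σ = D * p + x := by ring
    rw [this]
    field_simp
    ring
  have hx2 : 0 ≤ x ^ 2 / D := by positivity
  set τ := T / (K + 1) with hτ
  have hTτ : T = τ * (K + 1) := by rw [hτ, div_mul_cancel₀]; positivity
  have hτ0 : 0 ≤ τ := by positivity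
  have ha : 0 < 2 * p * (K + 1) - 1 := by linarith
  have hb : 0 ≤ 1 - 2 * p := by linarith
  have e1 : (2 * p * (K + 1) - 1) * h <
      (2 * p * (K + 1) - 1) * (D * p * (1 - p) + (1 - 2 * p) * x) := by
    refine mul_lt_mul_of_pos_left ?_ ha
    rw [hsq] at h1
    have : σ = D * p + x := by ring
    nlinarith
  have e2 : (1 - 2 * p) * h ≤
      (1 - 2 * p) * (D * p * (1 - p) - (2 * p * (K + 1) - 1) * x + 2 * p ^ 2 * T) := by
    refine mul_le_mul_of_nonneg_left ?_ hb
    have : σ = D * p + x := by ring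
    rw [this] at hh
    nlinarith [sq_nonneg x]
  have e3 : (1 - 2 * p) * (2 * p ^ 2 * T) ≤ 2 * p * K * (τ * p * (1 - p)) := by
    have h3 : (1 - 2 * p) * (K + 1) ≤ K * (1 - p) := by nlinarith
    have h4 := mul_le_mul_of_nonneg_left h3 (by positivity : 0 ≤ 2 * p ^ 2 * τ)
    rw [hTτ]
    nlinarith
  have h5 : 2 * p * K * h < 2 * p * K * (D * p * (1 - p) + τ * p * (1 - p)) := by
    nlinarith
  exact lt_of_mul_lt_mul_left h5 (by positivity)

namespace SimpleGraph

variable {V : Type*} [Fintype V] (G : SimpleGraph V)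

theorem two_mul_sum_edgeFinset [DecidableEq V] [DecidableRel G.Adj]
    (F : V → V → ℝ) (hF : ∀ u v, F u v = F v u) :
    2 * ∑ e ∈ G.edgeFinset, Sym2.lift ⟨F, hF⟩ e = ∑ u, ∑ v, if G.Adj u v then F u v else 0 := by
  have h1 : (∑ u, ∑ v, if G.Adj u v then F u v else 0) =
      ∑ q ∈ (univ : Finset (V × V)).filter (fun q => G.Adj q.1 q.2), F q.1 q.2 := by
    rw [sum_filter, ← univ_product_univ, sum_product]
  have hmaps : ∀ q ∈ (univ : Finset (V × V)).filter (fun q => G.Adj q.1 q.2),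
      s(q.1, q.2) ∈ G.edgeFinset := by
    intro q hq
    simpa using hq
  rw [h1, ← sum_fiberwise_of_maps_to hmaps, mul_sum]
  refine sum_congr rfl fun e he => ?_
  induction e with
  | _ a b =>
    have hab : G.Adj a b := by simpa using he
    have hfil : ((univ : Finset (V × V)).filter (fun q => G.Adj q.1 q.2)).filter
        (fun q => s(q.1, q.2) = s(a, b)) = {(a, b), (b, a)} := by
      ext ⟨c, d⟩
      simp only [mem_filter, mem_univ, true_and, mem_insert, mem_singleton, Prod.mk.injEq,
        Sym2.eq_iff]
      constructor
      · exact fun h => h.2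
      · rintro (⟨rfl, rfl⟩ | ⟨rfl, rfl⟩)
        · exact ⟨hab, Or.inl ⟨rfl, rfl⟩⟩
        · exact ⟨hab.symm, Or.inr ⟨rfl, rfl⟩⟩
    rw [hfil, sum_pair (by simp [hab.ne])]
    simp only [Sym2.lift_mk, hF b a]
    ring

/-- Twice the quadratic edge sum `Σ_{uv ∈ E} x_u x_v`. -/
noncomputable def edgeForm (x : V → ℝ) : ℝ :=
  letI : DecidableRel G.Adj := Classical.decRel _
  ∑ u, ∑ v, if G.Adj u v then x u * x v else 0

theorem edgeForm_def [DecidableRel G.Adj] (x : V → ℝ) :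
    G.edgeForm x = ∑ u, ∑ v, if G.Adj u v then x u * x v else 0 := by
  unfold edgeForm
  congr! 5

theorem f1_eq (s t : ℝ) (x : V → ℝ) :
    G.f1 s t x = G.edgeForm x / 2 - (s + t + 1) * ((s + 1) / (s + t + 2)) * ∑ v, x v := by
  classical
  have h := G.two_mul_sum_edgeFinset (fun u v => x u * x v) (fun _ _ => mul_comm _ _)
  rw [edgeForm_def, ← h]
  unfold f1
  rw [mul_div_cancel_left₀ _ two_ne_zero]

theorem g1_eq_f1 (s t : ℝ) (x : V → ℝ) : G.g1 s t x = G.f1 t s (fun v => 1 - x v) := by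
  unfold g1 f1
  rw [add_comm t s]

theorem f1_eq_g1 (s t : ℝ) (x : V → ℝ) : G.f1 s t x = G.g1 t s (fun v => 1 - x v) := by
  simp [g1_eq_f1]

theorem two_mul_edgesIn_univ [DecidableRel G.Adj] :
    2 * (G.edgesIn univ : ℝ) = ∑ v, (G.degree v : ℝ) := by
  classical
  have h : G.edgesIn univ = G.edgeFinset.card := by
    simp [edgesIn, Set.ncard_eq_toFinset_card', edgeFinset]
  rw [h, ← Nat.cast_sum, G.sum_degrees_eq_twice_card_edges]
  push_cast
  rfl

theorem edgeForm_one_sub [DecidableRel G.Adj] (x : V → ℝ) :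
    G.edgeForm (fun v => 1 - x v) =
      ∑ v, (G.degree v : ℝ) - 2 * ∑ v, (G.degree v : ℝ) * x v + G.edgeForm x := by
  classical
  have hd : ∀ u, (G.degree u : ℝ) = ∑ v, if G.Adj u v then (1 : ℝ) else 0 := by
    intro u
    rw [sum_boole, ← G.card_neighborFinset_eq_degree, G.neighborFinset_eq_filter]
  have h1 : ∑ u, (G.degree u : ℝ) * x u = ∑ u, ∑ v, if G.Adj u v then x u else 0 := by
    refine sum_congr rfl fun u _ => ?_
    simp only [hd, sum_mul, ite_mul, one_mul, zero_mul]
  have h2 : ∑ u, (G.degree u : ℝ) * x u = ∑ u, ∑ v, if G.Adj u v then x v else 0 := by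
    rw [h1, sum_comm]
    simp only [G.adj_comm]
  rw [two_mul]
  nth_rewrite 1 [h1]
  rw [h2, edgeForm_def, edgeForm_def]
  simp only [hd, ← sum_sub_distrib, ← sum_add_distrib]
  refine sum_congr rfl fun u _ => ?_
  refine sum_congr rfl fun v _ => ?_
  split_ifs <;> ring

theorem edgeForm_const [DecidableRel G.Adj] (c : ℝ) :
    G.edgeForm (fun _ => c) = c ^ 2 * ∑ v, (G.degree v : ℝ) := by
  classical
  rw [edgeForm_def, mul_sum]
  refine sum_congr rfl fun u _ => ?_
  rw [← sum_filter, sum_const, ← G.neighborFinset_eq_filter, G.card_neighborFinset_eq_degree,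
    nsmul_eq_mul]
  ring

theorem edgeForm_le_sq (x : V → ℝ) (hx : ∀ v, 0 ≤ x v) : G.edgeForm x ≤ (∑ v, x v) ^ 2 := by
  classical
  rw [edgeForm_def, sq, sum_mul_sum]
  refine sum_le_sum fun u _ => sum_le_sum fun v _ => ?_
  split_ifs
  · rfl
  · exact mul_nonneg (hx u) (hx v)

theorem edgeForm_of_isClique (x : V → ℝ) (hx : G.IsClique {v | x v ≠ 0}) :
    G.edgeForm x = (∑ v, x v) ^ 2 - ∑ v, x v ^ 2 := by
  classical
  rw [edgeForm_def, sq, sum_mul_sum, ← sum_sub_distrib]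
  refine sum_congr rfl fun u _ => ?_
  have h : x u ^ 2 = ∑ v, if v = u then x u * x v else 0 := by simp [sq]
  rw [h, ← sum_sub_distrib]
  refine sum_congr rfl fun v _ => ?_
  by_cases huv : v = u
  · subst huv
    simp
  by_cases hadj : G.Adj u v
  · simp [huv, hadj]
  · simp only [hadj, huv, if_false, sub_zero]
    by_contra h0
    have hu : x u ≠ 0 := fun h => h0 (by simp [h])
    have hv : x v ≠ 0 := fun h => h0 (by simp [h])
    exact hadj (hx hu hv (Ne.symm huv))

/-- The edge form is affine along directions supported on a set without edges. -/
theorem edgeForm_add_smul [DecidableRel G.Adj] (x d : V → ℝ) (r : ℝ)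
    (hd : ∀ u v, G.Adj u v → d u * d v = 0) :
    G.edgeForm (fun v => x v + r * d v) =
      G.edgeForm x + r * (2 * ∑ u, ∑ v, if G.Adj u v then d u * x v else 0) := by
  have h : (∑ u, ∑ v, if G.Adj u v then d u * x v else 0) =
      ∑ u, ∑ v, if G.Adj u v then d v * x u else 0 := by
    rw [sum_comm]
    simp only [G.adj_comm]
  rw [two_mul]
  nth_rewrite 1 [h]
  rw [edgeForm_def, edgeForm_def]
  simp only [mul_sum, ← sum_add_distrib]
  refine sum_congr rfl fun u _ => sum_congr rfl fun v _ => ?_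
  split_ifs with hadj
  · linear_combination r ^ 2 * hd u v hadj
  · simp

/-- Pushing along a weight-preserving direction at a non-adjacent fractional pair. -/
theorem exists_fewer_fractional_of_nonneg [DecidableEq V] [DecidableRel G.Adj] (w : V → ℝ)
    (hw : ∀ v, 0 < w v) (c : ℝ) (x d : V → ℝ) (hx : ∀ v, x v ∈ Set.Icc (0 : ℝ) 1) {a b : V}
    (hab : a ≠ b) (hadj : ¬ G.Adj a b) (ha : 0 < x a ∧ x a < 1) (hb : 0 < x b ∧ x b < 1)
    (hd : d = fun v => if v = a then w b else if v = b then -w a else 0)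
    (hD : 0 ≤ (∑ u, ∑ v, if G.Adj u v then d u * x v else 0) - c * ∑ v, d v) :
    ∃ y : V → ℝ, (∀ v, y v ∈ Set.Icc (0 : ℝ) 1) ∧ ∑ v, w v * y v = ∑ v, w v * x v ∧
      G.edgeForm x / 2 - c * ∑ v, x v ≤ G.edgeForm y / 2 - c * ∑ v, y v ∧
      univ.filter (fun v => 0 < y v ∧ y v < 1) ⊂ univ.filter (fun v => 0 < x v ∧ x v < 1) := by
  have hba : b ≠ a := hab.symm
  have hda : d a = w b := by simp [hd]
  have hdb : d b = -w a := by simp [hd, hba]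
  have hdo : ∀ v, v ≠ a → v ≠ b → d v = 0 := fun v h1 h2 => by simp [hd, h1, h2]
  have hdd : ∀ u v, G.Adj u v → d u * d v = 0 := by
    intro u v huv
    by_contra h0
    have hu : u = a ∨ u = b := by
      by_contra! h
      exact h0 (by simp [hdo u h.1 h.2])
    have hv : v = a ∨ v = b := by
      by_contra! h
      exact h0 (by simp [hdo v h.1 h.2])
    rcases hu with rfl | rfl <;> rcases hv with rfl | rfl
    · exact G.irrefl huv
    · exact hadj huv
    · exact hadj huv.symm
    · exact G.irrefl huv
  have hwd : ∑ v, w v * d v = 0 := by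
    rw [Fintype.sum_eq_add a b hab (fun v hv => by simp [hdo v hv.1 hv.2]), hda, hdb]
    ring
  set r := min ((1 - x a) / w b) (x b / w a) with hr
  have hwa := hw a
  have hwb := hw b
  have hr0 : 0 < r := lt_min (div_pos (by linarith) hwb) (div_pos hb.1 hwa)
  have hr1 : r * w b ≤ 1 - x a := (le_div_iff₀ hwb).1 (min_le_left _ _)
  have hr2 : r * w a ≤ x b := (le_div_iff₀ hwa).1 (min_le_right _ _)
  have hrb : 0 < r * w b := mul_pos hr0 hwb
  have hra : 0 < r * w a := mul_pos hr0 hwa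
  have hya : x a + r * d a = x a + r * w b := by rw [hda]
  have hyb : x b + r * d b = x b - r * w a := by rw [hdb]; ring
  have hyo : ∀ v, v ≠ a → v ≠ b → x v + r * d v = x v := fun v h1 h2 => by simp [hdo v h1 h2]
  refine ⟨fun v => x v + r * d v, fun v => ?_, ?_, ?_, ?_⟩
  · rcases eq_or_ne v a with rfl | h1
    · simp only [hya]
      constructor <;> linarith [ha.1]
    rcases eq_or_ne v b with rfl | h2
    · simp only [hyb]
      constructor <;> linarith [hb.2]
    · simpa only [hyo v h1 h2] using hx v
  · have : ∑ v, w v * (x v + r * d v) = ∑ v, w v * x v + r * ∑ v, w v * d v := by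
      rw [mul_sum, ← sum_add_distrib]
      exact sum_congr rfl fun v _ => by ring
    rw [this, hwd]
    ring
  · rw [G.edgeForm_add_smul x d r hdd, sum_add_distrib, ← mul_sum]
    nlinarith [mul_nonneg hr0.le hD]
  · have hsub : univ.filter (fun v => 0 < x v + r * d v ∧ x v + r * d v < 1) ⊆
        univ.filter (fun v => 0 < x v ∧ x v < 1) := by
      intro v hv
      simp only [mem_filter, mem_univ, true_and] at hv ⊢
      rcases eq_or_ne v a with rfl | h1
      · exact ha
      rcases eq_or_ne v b with rfl | h2
      · exact hb
      · rwa [hyo v h1 h2] at hv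
    refine (ssubset_iff_of_subset hsub).2 ?_
    rcases min_choice ((1 - x a) / w b) (x b / w a) with h | h
    · refine ⟨a, by simpa using ha, ?_⟩
      have : r * w b = 1 - x a := by rw [hr, h, div_mul_cancel₀ _ hwb.ne']
      simp only [mem_filter, mem_univ, true_and, hya, this]
      intro h'
      linarith [h'.2]
    · refine ⟨b, by simpa using hb, ?_⟩
      have : r * w a = x b := by rw [hr, h, div_mul_cancel₀ _ hwa.ne']
      simp only [mem_filter, mem_univ, true_and, hyb, this]
      intro h'
      linarith [h'.1]

theorem exists_isClique_fractional (w : V → ℝ) (hw : ∀ v, 0 < w v) (c : ℝ) (x : V → ℝ)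
    (hx : ∀ v, x v ∈ Set.Icc (0 : ℝ) 1) :
    ∃ y : V → ℝ, (∀ v, y v ∈ Set.Icc (0 : ℝ) 1) ∧ ∑ v, w v * y v = ∑ v, w v * x v ∧
      G.edgeForm x / 2 - c * ∑ v, x v ≤ G.edgeForm y / 2 - c * ∑ v, y v ∧
      G.IsClique {v | 0 < y v ∧ y v < 1} := by
  classical
  induction hn : (univ.filter (fun v => 0 < x v ∧ x v < 1)).card using Nat.strong_induction_on
    generalizing x with
  | _ n ih =>
    by_cases hcl : G.IsClique {v | 0 < x v ∧ x v < 1}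
    · exact ⟨x, hx, rfl, le_rfl, hcl⟩
    simp only [isClique_iff, Set.Pairwise, not_forall, Set.mem_ofPred_eq] at hcl
    obtain ⟨a, ha, b, hb, hab, hadj⟩ := hcl
    have hstep : ∃ y : V → ℝ, (∀ v, y v ∈ Set.Icc (0 : ℝ) 1) ∧
        ∑ v, w v * y v = ∑ v, w v * x v ∧
        G.edgeForm x / 2 - c * ∑ v, x v ≤ G.edgeForm y / 2 - c * ∑ v, y v ∧
        univ.filter (fun v => 0 < y v ∧ y v < 1) ⊂
          univ.filter (fun v => 0 < x v ∧ x v < 1) := by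
      set d : V → ℝ := fun v => if v = a then w b else if v = b then -w a else 0 with hd
      rcases le_total 0 ((∑ u, ∑ v, if G.Adj u v then d u * x v else 0) - c * ∑ v, d v)
        with h | h
      · exact G.exists_fewer_fractional_of_nonneg w hw c x d hx hab hadj ha hb hd h
      · refine G.exists_fewer_fractional_of_nonneg w hw c x (fun v => -d v) hx hab.symm
          (fun h' => hadj h'.symm) hb ha ?_ ?_
        · funext v
          rcases eq_or_ne v a with rfl | h1
          · simp [hd, hab]
          · by_cases h2 : v = b <;> simp [hd, h1, h2, hab.symm]
        · have : ∀ u v, (if G.Adj u v then -d u * x v else 0) =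
              -(if G.Adj u v then d u * x v else 0) := fun u v => by split_ifs <;> ring
          simp only [this, sum_neg_distrib]
          linarith
    obtain ⟨y, hy, hwy, hfy, hlt⟩ := hstep
    obtain ⟨z, hz, hwz, hfz, hcz⟩ := ih _ (hn ▸ card_lt_card hlt) y hy rfl
    exact ⟨z, hz, hwz.trans hwy, hfy.trans hfz, hcz⟩

theorem g1_eq_f1_sub [DecidableRel G.Adj] {s t p pb T : ℝ} (hst : s + t + 2 ≠ 0)
    (hp : p = (s + 1) / (s + t + 2)) (hpb : pb = (t + 1) / (s + t + 2))
    (hT : T = (G.edgesIn Finset.univ : ℝ) - (s + t + 1) * Fintype.card V) (x : V → ℝ) :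
    G.g1 s t x = pb ^ 2 * T + (G.f1 s t x - p ^ 2 * T) -
      (∑ v, ((G.degree v : ℝ) - (s + t + 1)) * x v -
        p * ∑ v, ((G.degree v : ℝ) - (s + t + 1))) := by
  have hpp : pb = 1 - p := by
    rw [hp, hpb]
    field_simp
    ring
  have hE := G.two_mul_edgesIn_univ
  rw [g1_eq_f1, f1_eq, f1_eq, edgeForm_one_sub, add_comm t s, ← hp, ← hpb, hpp]
  simp only [sub_mul, sum_sub_distrib, sum_const, card_univ, nsmul_eq_mul, mul_one, ← mul_sum]
  rw [← hE]
  have hE' : (G.edgesIn univ : ℝ) = T + (s + t + 1) * Fintype.card V := by linarith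
  rw [hE']
  ring

theorem f1_const [DecidableRel G.Adj] {s t p T : ℝ} (hp : p = (s + 1) / (s + t + 2))
    (hT : T = (G.edgesIn Finset.univ : ℝ) - (s + t + 1) * Fintype.card V) :
    G.f1 s t (fun _ => p) = p ^ 2 * T := by
  rw [f1_eq, edgeForm_const, ← G.two_mul_edgesIn_univ, ← hp, hT]
  simp only [sum_const, card_univ, nsmul_eq_mul]
  ring

theorem two_mul_le_sum_of_f1_nonneg {s t : ℝ} {x : V → ℝ} (hx : ∀ v, 0 ≤ x v)
    (hx0 : x ≠ fun _ => 0) (hf : 0 ≤ G.f1 s t x) :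
    2 * (s + t + 1) * ((s + 1) / (s + t + 2)) ≤ ∑ v, x v := by
  have hpos : 0 < ∑ v, x v := by
    obtain ⟨v, hv⟩ := Function.ne_iff.1 hx0
    exact sum_pos' (fun v _ => hx v) ⟨v, mem_univ v, lt_of_le_of_ne (hx v) (Ne.symm hv)⟩
  rw [f1_eq] at hf
  have h := G.edgeForm_le_sq x hx
  by_contra! hlt
  nlinarith [mul_lt_mul_of_pos_right hlt hpos]

/-- A fractional solution with clique support whose fractional coordinates satisfy the quadratic
bound obtained by comparing `f₁` with its value on the fractional part alone. -/
theorem exists_fractional_clique_of_f1 [Nonempty V] [DecidableRel G.Adj]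
    {s t p T : ℝ} (hst : 0 < s + t + 1) (hp0 : 0 < p) (hp1 : p ≤ 1)
    (hp : p = (s + 1) / (s + t + 2))
    (hT : T = (G.edgesIn Finset.univ : ℝ) - (s + t + 1) * Fintype.card V)
    (hT0 : 0 ≤ T) (hdeg : ∀ v : V, s + t + 1 < (G.degree v : ℝ)) :
    ∃ x : V → ℝ, (∀ v, x v ∈ Set.Icc (0 : ℝ) 1) ∧ p ^ 2 * T ≤ G.f1 s t x ∧
      ∑ v, ((G.degree v : ℝ) - (s + t + 1)) * x v ≤
        p * ∑ v, ((G.degree v : ℝ) - (s + t + 1)) ∧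
      x ≠ (fun _ => 0) ∧ G.IsClique {v | 0 < x v ∧ x v < 1} ∧
      (∑ v ∈ univ.filter (fun v => 0 < x v ∧ x v < 1), (x v - x v ^ 2)) ≤
        (∑ v ∈ univ.filter (fun v => 0 < x v ∧ x v < 1), x v) *
          (1 + 2 * (s + t + 1) * p -
            ∑ v ∈ univ.filter (fun v => 0 < x v ∧ x v < 1), x v) + 2 * p ^ 2 * T := by
  classical
  set w : V → ℝ := fun v => (G.degree v : ℝ) - (s + t + 1) with hw
  have hw0 : ∀ v, 0 < w v := fun v => sub_pos.2 (hdeg v)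
  have hW : 0 < ∑ v, w v := sum_pos (fun v _ => hw0 v) univ_nonempty
  have hpT : 0 ≤ p ^ 2 * T := by positivity
  obtain ⟨y, hy, hwy, hfy, hcl⟩ := G.exists_isClique_fractional w hw0 ((s + t + 1) * p)
    (fun _ => p) fun _ => ⟨hp0.le, hp1⟩
  rw [← sum_mul, mul_comm] at hwy
  have hf1 : ∀ x, G.f1 s t x = G.edgeForm x / 2 - (s + t + 1) * p * ∑ v, x v :=
    fun x => by rw [f1_eq, ← hp]
  rw [← hf1, ← hf1, G.f1_const hp hT] at hfy
  have hy0 : y ≠ fun _ => 0 := by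
    rintro rfl
    simp only [mul_zero, sum_const_zero] at hwy
    exact (mul_pos hp0 hW).ne hwy
  set C := univ.filter (fun v => 0 < y v ∧ y v < 1) with hC
  by_cases hgood : (∑ v ∈ C, (y v - y v ^ 2)) ≤ (∑ v ∈ C, y v) *
      (1 + 2 * (s + t + 1) * p - ∑ v ∈ C, y v) + 2 * p ^ 2 * T
  · exact ⟨y, hy, hfy, hwy.le, hy0, hcl, hgood⟩
  push Not at hgood
  rw [sum_sub_distrib] at hgood
  set σ := ∑ v ∈ C, y v with hσ
  set q := ∑ v ∈ C, y v ^ 2 with hq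
  have hσ0 : 0 ≤ σ := sum_nonneg fun v _ => (hy v).1
  have hq0 : 0 ≤ q := sum_nonneg fun v _ => sq_nonneg _
  have hσpos : 0 < σ := by
    refine hσ0.lt_of_ne fun h => ?_
    rw [← h] at hgood
    linarith
  set e := (σ ^ 2 - q) / 2 with he
  set a := (s + t + 1) * p * σ with ha
  have ha0 : 0 < a := by
    positivity
  have hea : a + p ^ 2 * T < e := by
    rw [he, ha]
    linarith
  have he0 : 0 < e := by linarith
  have hθ₀ : a / e ≤ 1 := (div_le_one he0).2 (by linarith)
  obtain ⟨θ, ⟨hθa, hθ1⟩, hθ⟩ :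
      p ^ 2 * T ∈ (fun θ : ℝ => θ ^ 2 * e - θ * a) '' Set.Icc (a / e) 1 := by
    refine intermediate_value_Icc hθ₀ (by fun_prop) ⟨?_, ?_⟩
    · have : (a / e) ^ 2 * e - a / e * a = 0 := by
        field_simp
        ring
      simpa only [this] using hpT
    · simp only [one_pow, one_mul]
      linarith
  simp only at hθ
  have hθ0 : 0 < θ := (div_pos ha0 he0).trans_le hθa
  set x : V → ℝ := fun v => if v ∈ C then θ * y v else 0 with hxdef
  have hmem : ∀ v, v ∈ C ↔ 0 < y v ∧ y v < 1 := fun v => by simp [hC]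
  have hxle : ∀ v, 0 ≤ x v ∧ x v ≤ y v := by
    intro v
    simp only [hxdef]
    split_ifs
    · exact ⟨mul_nonneg hθ0.le (hy v).1, mul_le_of_le_one_left (hy v).1 hθ1⟩
    · exact ⟨le_rfl, (hy v).1⟩
  have hxC : ∀ v, 0 < x v ↔ v ∈ C := by
    intro v
    by_cases hv : v ∈ C
    · simpa [hxdef, hv] using mul_pos hθ0 ((hmem v).1 hv).1
    · simp [hxdef, hv]
  have hfrac : univ.filter (fun v => 0 < x v ∧ x v < 1) = C := by
    ext v
    simp only [mem_filter, mem_univ, true_and, hxC]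
    exact ⟨fun h => h.1, fun h => ⟨h, (hxle v).2.trans_lt ((hmem v).1 h).2⟩⟩
  have hsum : ∑ v ∈ C, x v = θ * σ := by
    rw [hσ, mul_sum]
    exact sum_congr rfl fun v hv => by simp [hxdef, hv]
  have hsumsq : ∑ v ∈ C, x v ^ 2 = θ ^ 2 * q := by
    rw [hq, mul_sum]
    exact sum_congr rfl fun v hv => by simp [hxdef, hv, mul_pow]
  have hzero : ∀ v ∈ univ, v ∉ C → x v = 0 := fun v _ hv => by simp [hxdef, hv]
  have hcl' : G.IsClique {v | x v ≠ 0} := hcl.subset fun v hv =>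
    (hmem v).1 ((hxC v).1 ((hxle v).1.lt_of_ne (Ne.symm hv)))
  have hfx : G.f1 s t x = p ^ 2 * T := by
    rw [hf1, G.edgeForm_of_isClique x hcl', ← sum_subset (subset_univ C) hzero,
      ← sum_subset (subset_univ C) (fun v hv hvC => by rw [hzero v hv hvC, zero_pow two_ne_zero]),
      hsum, hsumsq, ← hθ, he, ha]
    ring
  refine ⟨x, fun v => ⟨(hxle v).1, (hxle v).2.trans (hy v).2⟩, hfx.ge, ?_, ?_, ?_, ?_⟩
  · rw [← hwy]
    exact sum_le_sum fun v _ => mul_le_mul_of_nonneg_left (hxle v).2 (hw0 v).le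
  · intro h
    have : θ * σ = 0 := by
      rw [← hsum, h, sum_const_zero]
    exact (mul_pos hθ0 hσpos).ne' this
  · exact hcl'.subset fun v hv => hv.1.ne'
  · rw [hfrac, sum_sub_distrib, hsum, hsumsq]
    have : 2 * p ^ 2 * T = 2 * (θ ^ 2 * e - θ * a) := by rw [hθ]; ring
    rw [this, he, ha]
    apply le_of_eq
    ring

theorem exists_fractional_clique_solution_of_le [Nonempty V] [DecidableRel G.Adj]
    {s t p pb T : ℝ} (hs : 0 ≤ s) (hst : s ≤ t)
    (hp : p = (s + 1) / (s + t + 2)) (hpb : pb = (t + 1) / (s + t + 2))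
    (hT : T = (G.edgesIn Finset.univ : ℝ) - (s + t + 1) * Fintype.card V)
    (hT0 : 0 ≤ T)
    (hdeg : ∀ v : V, s + t + 1 < (G.degree v : ℝ))
    (hclique : ∀ K : Finset V, G.IsClique (K : Set V) → (K.card : ℝ) < 2 * s + 2 * t + 3) :
    ∃ y : V → ℝ, (∀ v, y v ∈ Set.Icc (0 : ℝ) 1) ∧
      p ^ 2 * T ≤ G.f1 s t y ∧ pb ^ 2 * T ≤ G.g1 s t y ∧
      y ≠ (fun _ => 0) ∧ y ≠ (fun _ => 1) ∧
      G.IsClique {v | 0 < y v ∧ y v < 1} ∧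
      (∑ v ∈ Finset.univ.filter (fun v => 0 < y v ∧ y v < 1), (y v - (y v) ^ 2)) <
        (2 * s + 2 * t + 3) * p * (1 - p) + (T / (s + t + 2)) * p * (1 - p) ∧
      2 * (s + t + 1) * p ≤ ∑ v, y v ∧
      2 * (s + t + 1) * pb ≤ ∑ v, (1 - y v) := by
  have hK2 : 0 < s + t + 2 := by linarith
  have hp0 : 0 < p := by rw [hp]; exact div_pos (by linarith) hK2
  have hp2 : p ≤ 1 / 2 := by rw [hp, div_le_iff₀ hK2]; linarith
  have hpK : 1 ≤ p * (s + t + 1 + 1) := by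
    have : p * (s + t + 1 + 1) = s + 1 := by
      rw [hp]
      field_simp
      ring
    linarith
  set w : V → ℝ := fun v => (G.degree v : ℝ) - (s + t + 1) with hw
  have hw0 : ∀ v, 0 < w v := fun v => sub_pos.2 (hdeg v)
  have hW : 0 < ∑ v, w v := sum_pos (fun v _ => hw0 v) univ_nonempty
  have hpT : 0 ≤ p ^ 2 * T := by positivity
  have hg : ∀ x, G.g1 s t x = pb ^ 2 * T + (G.f1 s t x - p ^ 2 * T) -
      (∑ v, w v * x v - p * ∑ v, w v) := G.g1_eq_f1_sub hK2.ne' hp hpb hT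
  obtain ⟨x, hx, hf, hL, hx0, hcl, hh⟩ := G.exists_fractional_clique_of_f1 (by linarith) hp0
    (by linarith) hp hT hT0 hdeg
  have hgx : pb ^ 2 * T ≤ G.g1 s t x := by rw [hg]; linarith
  have hx1 : x ≠ fun _ => 1 := by
    rintro rfl
    simp only [mul_one] at hL
    nlinarith
  refine ⟨x, hx, hf, hgx, hx0, hx1, hcl, ?_, ?_, ?_⟩
  · set C := univ.filter (fun v => 0 < x v ∧ x v < 1) with hC
    have hcard : (C.card : ℝ) < 2 * (s + t + 1) + 1 := by
      have := hclique C (by simpa [hC] using hcl)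
      linarith
    have hsq : 0 ≤ ∑ v ∈ C, x v ^ 2 := sum_nonneg fun v _ => sq_nonneg _
    have hcs : (∑ v ∈ C, x v) ^ 2 ≤ C.card * ∑ v ∈ C, x v ^ 2 := sq_sum_le_card_mul_sum_sq
    have hsub : ∑ v ∈ C, (x v - x v ^ 2) = ∑ v ∈ C, x v - ∑ v ∈ C, x v ^ 2 :=
      sum_sub_distrib _ _
    have := fractional_sum_lt (by linarith) hp0 hp2 hpK hT0
      (sum_nonneg fun v _ => (hx v).1) (by linarith) hcard
      (by rw [hsub, sub_sub_cancel]; exact hcs) hh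
    convert this using 2 <;> ring_nf
  · rw [hp]
    exact G.two_mul_le_sum_of_f1_nonneg (fun v => (hx v).1) hx0 (hpT.trans hf)
  · have h0 : 0 ≤ G.f1 t s (fun v => 1 - x v) := by
      rw [← g1_eq_f1]
      exact le_trans (by positivity) hgx
    have h1 : (fun v => 1 - x v) ≠ fun _ => 0 := fun h => hx1 <| funext fun v => by
      linarith [congrFun h v]
    have := G.two_mul_le_sum_of_f1_nonneg (fun v => sub_nonneg.2 (hx v).2) h1 h0
    rwa [hpb, add_comm s t]

end SimpleGraph

/-- Existence of a fractional solution whose fractional support is a clique: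
if `s, t > 1/2`, `T = ‖V‖ - (s+t+1)|V| ≥ 0`, every vertex has degree `> s+t+1+T`,
and `G` has no clique of size at least `2s+2t+3`, then there is `y ∈ [0,1]^V` with
`f₁(y) ≥ p²T`, `g₁(y) ≥ p̄²T`, `y ∉ {0⃗, 1⃗}`, `C := fr(y)` a clique,
`Σ_{v ∈ C} (y_v - y_v²) < (2s+2t+3) p (1-p) + (T/(s+t+2)) p (1-p)`,
`Σ_v y_v ≥ 2(s+t+1) p` and `Σ_v (1-y_v) ≥ 2(s+t+1) p̄`. -/
theorem exists_fractional_clique_solution {V : Type*} [Fintype V] [Nonempty V]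
    (G : SimpleGraph V) [DecidableRel G.Adj] (s t p pb T : ℝ)
    (hs : 1 / 2 < s) (ht : 1 / 2 < t)
    (hp : p = (s + 1) / (s + t + 2)) (hpb : pb = (t + 1) / (s + t + 2))
    (hT : T = (G.edgesIn Finset.univ : ℝ) - (s + t + 1) * Fintype.card V)
    (hT0 : 0 ≤ T)
    (hdeg : ∀ v : V, s + t + 1 + T < (G.degree v : ℝ))
    (hclique : ∀ K : Finset V, G.IsClique (K : Set V) → (K.card : ℝ) < 2 * s + 2 * t + 3) :
    ∃ y : V → ℝ, (∀ v, y v ∈ Set.Icc (0 : ℝ) 1) ∧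
      p ^ 2 * T ≤ G.f1 s t y ∧ pb ^ 2 * T ≤ G.g1 s t y ∧
      y ≠ (fun _ => 0) ∧ y ≠ (fun _ => 1) ∧
      G.IsClique {v | 0 < y v ∧ y v < 1} ∧
      (∑ v ∈ Finset.univ.filter (fun v => 0 < y v ∧ y v < 1), (y v - (y v) ^ 2)) <
        (2 * s + 2 * t + 3) * p * (1 - p) + (T / (s + t + 2)) * p * (1 - p) ∧
      2 * (s + t + 1) * p ≤ ∑ v, y v ∧
      2 * (s + t + 1) * pb ≤ ∑ v, (1 - y v) := by
  rcases le_total s t with hst | hst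
  · exact G.exists_fractional_clique_solution_of_le (by linarith) hst hp hpb hT hT0
      (fun v => by linarith [hdeg v]) hclique
  · have hpp : pb = 1 - p := by
      have : s + t + 2 ≠ 0 := by linarith
      rw [hp, hpb]
      field_simp
      ring
    obtain ⟨y, hy, hf, hg, hy0, hy1, hcl, hsum, h1, h2⟩ :=
      G.exists_fractional_clique_solution_of_le (s := t) (t := s) (p := pb) (pb := p) (T := T)
        (by linarith) hst (by rw [hpb, add_comm t s]) (by rw [hp, add_comm t s])
        (by rw [hT, add_comm t s]) hT0 (fun v => by linarith [hdeg v])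
        (fun K hK => by linarith [hclique K hK])
    have hfrac : ∀ v, (0 < 1 - y v ∧ 1 - y v < 1) ↔ (0 < y v ∧ y v < 1) := fun v =>
      ⟨fun h => ⟨by linarith [h.2], by linarith [h.1]⟩,
        fun h => ⟨by linarith [h.2], by linarith [h.1]⟩⟩
    refine ⟨fun v => 1 - y v, fun v => ⟨by linarith [(hy v).2], by linarith [(hy v).1]⟩,
      by rwa [← G.g1_eq_f1], by rwa [← G.f1_eq_g1],
      fun h => hy1 ?_, fun h => hy0 ?_, ?_, ?_, ?_, ?_⟩
    · exact funext fun v => by linarith [congrFun h v]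
    · exact funext fun v => by linarith [congrFun h v]
    · simpa only [hfrac] using hcl
    · simp only [hfrac]
      have hsq : ∀ v, 1 - y v - (1 - y v) ^ 2 = y v - y v ^ 2 := fun v => by ring
      simp only [hsq]
      rw [hpp, add_comm t s] at hsum
      linarith
    · linarith
    · simp only [sub_sub_cancel]
      linarith
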